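/- Let p ≥ 3 be a natural number and define F₁₁, F₁₂ as in the context. Then for every real t ≥ 0, ∑_{m,l ≥ 1, m+l < p} [ F₁₂(p−m, p−l; t) + 2·F₁₁(p−m, 2p−l; t) ] > 0, where the sum runs over pairs of positive integers (m,l) with m + l < p. -/

import Mathlib

noncomputable def c (p k : ℕ) : ℝ :=
  if k = p then 1 / (p : ℝ)
  else (2 * (p : ℝ)^2 * Real.sin (Real.pi * k / p)) /
       (Real.pi * (k : ℝ) * ((p : ℝ)^2 - (k : ℝ)^2))

noncomputable def d (p k : ℕ) : ℝ :=
  if k = p ∨ k = 2 * p then 1 / (p : ℝ)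
  else (6 * (p : ℝ)^2 * (k : ℝ) * Real.sin (Real.pi * k / p)) /
       (Real.pi * ((p : ℝ)^2 - (k : ℝ)^2) * (4 * (p : ℝ)^2 - (k : ℝ)^2))

noncomputable def F11 (p m l : ℕ) (t : ℝ) : ℝ :=
  c p m * d p l * c p (m + l) *
    Real.exp (-2 * ((m : ℝ)^2 + (l : ℝ)^2 + (m : ℝ) * (l : ℝ)) * t)

noncomputable def F12 (p m l : ℕ) (t : ℝ) : ℝ :=
  c p m * c p l * d p (m + l) *
    Real.exp (-2 * ((m : ℝ)^2 + (l : ℝ)^2 + (m : ℝ) * (l : ℝ)) * t)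

lemma sin_pi_mul_div_pos {p k : ℕ} (hk : 0 < k) (hkp : k < p) :
    0 < Real.sin (Real.pi * k / p) := by
  have hk' : (0 : ℝ) < k := by exact_mod_cast hk
  have hkp' : (k : ℝ) < p := by exact_mod_cast hkp
  have hp : (0 : ℝ) < p := hk'.trans hkp'
  apply Real.sin_pos_of_pos_of_lt_pi
  · have := Real.pi_pos
    positivity
  · rw [div_lt_iff₀ hp]
    exact mul_lt_mul_of_pos_left hkp' Real.pi_pos

lemma c_sub {p k : ℕ} (hk : 0 < k) (hkp : k < p) :
    c p (p - k) = 2 * (p : ℝ) ^ 2 * Real.sin (Real.pi * k / p) /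
      (Real.pi * ((p - k) * k * (2 * p - k))) := by
  have hp : (p : ℝ) ≠ 0 := by
    have : p ≠ 0 := by omega
    exact_mod_cast this
  have hs : Real.pi * (p - k : ℝ) / p = Real.pi - Real.pi * k / p := by
    field_simp
  rw [c, if_neg (by omega), Nat.cast_sub hkp.le, hs, Real.sin_pi_sub]
  congr 1
  ring

lemma c_three_mul_sub {p k : ℕ} (hk : 0 < k) (hkp : k < p) :
    c p (3 * p - k) = -(2 * (p : ℝ) ^ 2 * Real.sin (Real.pi * k / p) /
      (Real.pi * ((3 * p - k) * (2 * p - k) * (4 * p - k)))) := by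
  have hp : (p : ℝ) ≠ 0 := by
    have : p ≠ 0 := by omega
    exact_mod_cast this
  have hs : Real.pi * (3 * p - k : ℝ) / p = Real.pi - Real.pi * k / p + 2 * Real.pi := by
    field_simp
    ring
  rw [c, if_neg (by omega), Nat.cast_sub (by omega)]
  push_cast
  rw [hs, Real.sin_add_two_pi, Real.sin_pi_sub, ← div_neg]
  congr 1
  ring

lemma d_two_mul_sub {p k : ℕ} (hk : 0 < k) (hkp : k < p) :
    d p (2 * p - k) = 6 * (p : ℝ) ^ 2 * (2 * p - k) * Real.sin (Real.pi * k / p) /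
      (Real.pi * ((p - k) * (3 * p - k) * k * (4 * p - k))) := by
  have hp : (p : ℝ) ≠ 0 := by
    have : p ≠ 0 := by omega
    exact_mod_cast this
  have hs : Real.pi * (2 * p - k : ℝ) / p = 2 * Real.pi - Real.pi * k / p := by
    field_simp
  rw [d, if_neg (by omega), Nat.cast_sub (by omega)]
  push_cast
  rw [hs, Real.sin_two_pi_sub, mul_neg, ← neg_div_neg_eq, neg_neg]
  congr 1
  ring

lemma F12_add_two_mul_F11_pos {p m l : ℕ} (hm : 0 < m) (hl : 0 < l) (hml : m + l < p)
    {t : ℝ} (ht : 0 ≤ t) :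
    0 < F12 p (p - m) (p - l) t + 2 * F11 p (p - m) (2 * p - l) t := by
  have hm' : (0 : ℝ) < m := by exact_mod_cast hm
  have hl' : (0 : ℝ) < l := by exact_mod_cast hl
  have hml' : (m : ℝ) + l < p := by exact_mod_cast hml
  have hπ := Real.pi_pos
  have ha := sin_pi_mul_div_pos hl (show l < p by omega)
  have hb := sin_pi_mul_div_pos (show 0 < m + l by omega) hml
  have hcm : 0 < c p (p - m) := by
    have hsm := sin_pi_mul_div_pos hm (show m < p by omega)
    rw [c_sub hm (by omega)]
    have h1 : (0 : ℝ) < p - m := by linarith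
    have h2 : (0 : ℝ) < 2 * p - m := by linarith
    have h3 : (0 : ℝ) < p := by linarith
    positivity
  have hB : d p (2 * p - l) * c p (3 * p - (m + l)) ≤ 0 ∧
      0 < c p (p - l) * d p (2 * p - (m + l)) +
        2 * (d p (2 * p - l) * c p (3 * p - (m + l))) := by
    rw [d_two_mul_sub hl (by omega), c_three_mul_sub (by omega) hml, c_sub hl (by omega),
      d_two_mul_sub (by omega) hml]
    generalize Real.sin (Real.pi * l / p) = a at ha ⊢
    generalize Real.sin (Real.pi * (m + l : ℕ) / p) = b at hb ⊢
    push_cast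
    have hls : (l : ℝ) < m + l := by linarith
    generalize (m : ℝ) + l = s at hml' hls ⊢
    generalize (l : ℝ) = y at hl' hls ⊢
    generalize (p : ℝ) = q at hml' ⊢
    have hq : 0 < q := by linarith
    have hs : 0 < s := by linarith
    have y1 : 0 < q - y := by linarith
    have y2 : 0 < 2 * q - y := by linarith
    have y3 : 0 < 3 * q - y := by linarith
    have y4 : 0 < 4 * q - y := by linarith
    have s1 : 0 < q - s := by linarith
    have s2 : 0 < 2 * q - s := by linarith
    have s3 : 0 < 3 * q - s := by linarith
    have s4 : 0 < 4 * q - s := by linarith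
    constructor
    · rw [mul_neg, neg_nonpos]
      positivity
    · have key : 0 < (2 * q - s) ^ 2 * ((3 * q - y) * (4 * q - y)) -
          2 * (2 * q - y) ^ 2 * (s * (q - s)) := by
        have h1 : s * (q - s) ≤ (2 * q - s) ^ 2 / 4 := by
          nlinarith [mul_pos s1 hq, sq_nonneg (q - 2 * s)]
        have h2 : (2 * q - y) ^ 2 < (3 * q - y) * (4 * q - y) := by nlinarith
        have h3 := mul_le_mul_of_nonneg_left h1 (sq_nonneg (2 * q - y))
        have h4 := mul_lt_mul_of_pos_left h2 (pow_pos s2 2)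
        have h5 : 0 < (2 * q - s) ^ 2 * (2 * q - y) ^ 2 := by positivity
        linarith
      have := div_pos (mul_pos (show 0 < 12 * q ^ 4 * a * b by positivity) key)
        (show 0 < Real.pi ^ 2 * ((q - y) * y * (2 * q - y) * (q - s) * (3 * q - s) * s *
          (4 * q - s) * (3 * q - y) * (4 * q - y) * (2 * q - s)) by positivity)
      refine this.trans_eq ?_
      generalize q - y = u₁ at *
      generalize 2 * q - y = u₂ at *
      generalize 3 * q - y = u₃ at *
      generalize 4 * q - y = u₄ at *
      generalize q - s = v₁ at *
      generalize 2 * q - s = v₂ at *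
      generalize 3 * q - s = v₃ at *
      generalize 4 * q - s = v₄ at *
      field_simp
      ring
  obtain ⟨hB, hAB⟩ := hB
  have e1 : p - m + (p - l) = 2 * p - (m + l) := by omega
  have e2 : p - m + (2 * p - l) = 3 * p - (m + l) := by omega
  have hE : Real.exp (-2 * (((p - m : ℕ) : ℝ) ^ 2 + ((2 * p - l : ℕ) : ℝ) ^ 2 +
        ((p - m : ℕ) : ℝ) * ((2 * p - l : ℕ) : ℝ)) * t) ≤
      Real.exp (-2 * (((p - m : ℕ) : ℝ) ^ 2 + ((p - l : ℕ) : ℝ) ^ 2 +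
        ((p - m : ℕ) : ℝ) * ((p - l : ℕ) : ℝ)) * t) := by
    have hle : ((p - l : ℕ) : ℝ) ≤ ((2 * p - l : ℕ) : ℝ) := by
      exact_mod_cast (by omega : p - l ≤ 2 * p - l)
    rw [Real.exp_le_exp]
    refine mul_le_mul_of_nonneg_right (mul_le_mul_of_nonpos_left ?_ (by norm_num)) ht
    gcongr
  rw [F12, F11, e1, e2]
  set E₁ := Real.exp (-2 * (((p - m : ℕ) : ℝ) ^ 2 + ((p - l : ℕ) : ℝ) ^ 2 +
    ((p - m : ℕ) : ℝ) * ((p - l : ℕ) : ℝ)) * t)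
  have hpos : 0 < E₁ := Real.exp_pos _
  have h1 := mul_pos hcm (mul_pos hAB hpos)
  have h2 := mul_le_mul_of_nonneg_left (mul_le_mul_of_nonpos_left hE hB) hcm.le
  linarith

theorem J12red_J11turq_pos (p : ℕ) (hp : 3 ≤ p) (t : ℝ) (ht : 0 ≤ t) :
    0 < ∑ m ∈ Finset.Ico 1 p, ∑ l ∈ Finset.Ico 1 p,
        if m + l < p then
          F12 p (p - m) (p - l) t + 2 * F11 p (p - m) (2 * p - l) t
        else 0 := by
  have hterm : ∀ m ∈ Finset.Ico 1 p, ∀ l ∈ Finset.Ico 1 p,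
      0 ≤ if m + l < p then
          F12 p (p - m) (p - l) t + 2 * F11 p (p - m) (2 * p - l) t
        else 0 := by
    intro m hm l hl
    split_ifs with h
    · exact (F12_add_two_mul_F11_pos (Finset.mem_Ico.1 hm).1 (Finset.mem_Ico.1 hl).1 h ht).le
    · exact le_rfl
  have h1 : 1 ∈ Finset.Ico 1 p := Finset.mem_Ico.2 ⟨le_rfl, by omega⟩
  refine Finset.sum_pos' (fun m hm => Finset.sum_nonneg (hterm m hm)) ⟨1, h1, ?_⟩
  refine Finset.sum_pos' (hterm 1 h1) ⟨1, h1, ?_⟩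
  rw [if_pos (by omega)]
  exact F12_add_two_mul_F11_pos one_pos one_pos (by omega) ht
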